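/- The pairing ⟨P, Q⟩ = P_AC·Q_AC + P_BD·Q_BD is a positive definite inner product on the real vector space Π: it is symmetric and bilinear, ⟨P, P⟩ ≥ 0 for all P ∈ Π, and ⟨P, P⟩ = 0 if and only if P is the zero tuple of ℝ⁹. -/

import Mathlib

noncomputable section

open Real Set

/-- Membership predicate for conformally inscribed parallelograms.
Coordinates of `P : Fin 9 → ℝ`:
`0 = x_A, 1 = y_A, 2 = x_B, 3 = y_B, 4 = x_C, 5 = y_C, 6 = x_D, 7 = y_D, 8 = w`.
The vertex `(x_L, y_L)` lies on the line `L(w)` for `L ∈ {A,B,C,D}` and the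
midpoints of the two diagonals coincide. -/
def IsCIP (mA mB mC mD bA : ℝ) (P : Fin 9 → ℝ) : Prop :=
  P 1 = mA * P 0 + bA * P 8 ∧
  P 3 = mB * P 2 + P 8 ∧
  P 5 = mC * P 4 ∧
  P 7 = mD * P 6 ∧
  P 0 + P 4 = P 2 + P 6 ∧
  P 1 + P 5 = P 3 + P 7

/-- `Π`, the set of conformally inscribed parallelograms. -/
def CIP (mA mB mC mD bA : ℝ) : Set (Fin 9 → ℝ) := {P | IsCIP mA mB mC mD bA P}

/-- The `AC` diagonal vector of a parallelogram. -/
def vAC (P : Fin 9 → ℝ) : ℝ × ℝ := (P 0 - P 4, P 1 - P 5)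

/-- The `BD` diagonal vector of a parallelogram. -/
def vBD (P : Fin 9 → ℝ) : ℝ × ℝ := (P 2 - P 6, P 3 - P 7)

/-- The `AB` side vector of a parallelogram. -/
def vAB (P : Fin 9 → ℝ) : ℝ × ℝ := (P 0 - P 2, P 1 - P 3)

/-- The `BC` side vector of a parallelogram. -/
def vBC (P : Fin 9 → ℝ) : ℝ × ℝ := (P 2 - P 4, P 3 - P 5)

/-- Dot product in `ℝ²`. -/
def dot2 (a b : ℝ × ℝ) : ℝ := a.1 * b.1 + a.2 * b.2

/-- The inner product `⟨P, Q⟩ = P_AC · Q_AC + P_BD · Q_BD` on `Π`. -/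
def pinner (P Q : Fin 9 → ℝ) : ℝ := dot2 (vAC P) (vAC Q) + dot2 (vBD P) (vBD Q)

/-- An inscribed parallelogram both of whose diagonals vanish is the zero tuple. -/
theorem CIP.eq_zero_of_pinner_self_eq_zero {mA mB mC mD bA : ℝ} (hCD : mC ≠ mD)
    {P : Fin 9 → ℝ} (hP : P ∈ CIP mA mB mC mD bA) (h : pinner P P = 0) : P = 0 := by
  obtain ⟨hA, hB, hC, hD, hx, hy⟩ := hP
  simp only [pinner, dot2, vAC, vBD] at h
  have h04 : P 0 - P 4 = 0 := mul_self_eq_zero.mp (by nlinarith)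
  have h15 : P 1 - P 5 = 0 := mul_self_eq_zero.mp (by nlinarith)
  have h26 : P 2 - P 6 = 0 := mul_self_eq_zero.mp (by nlinarith)
  have h37 : P 3 - P 7 = 0 := mul_self_eq_zero.mp (by nlinarith)
  have h46 : P 4 = P 6 := by linarith
  have h4 : P 4 = 0 := by
    have hmul : (mC - mD) * P 4 = 0 := by
      rw [← h46] at hD
      linarith
    exact (mul_eq_zero.mp hmul).resolve_left (sub_ne_zero.mpr hCD)
  have h6 : P 6 = 0 := h46 ▸ h4
  have h0 : P 0 = 0 := by linarith
  have h2 : P 2 = 0 := by linarith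
  have h5 : P 5 = 0 := by simp [hC, h4]
  have h7 : P 7 = 0 := by simp [hD, h6]
  have h1 : P 1 = 0 := by linarith
  have h3 : P 3 = 0 := by linarith
  have h8 : P 8 = 0 := by
    rw [h2, mul_zero] at hB
    linarith
  funext i
  fin_cases i <;> assumption

theorem stmt_3 (mA mB mC mD bA : ℝ) (hCD : mC ≠ mD) :
    (∀ P ∈ CIP mA mB mC mD bA, ∀ Q ∈ CIP mA mB mC mD bA, pinner P Q = pinner Q P) ∧
    (∀ P ∈ CIP mA mB mC mD bA, ∀ Q ∈ CIP mA mB mC mD bA, ∀ R ∈ CIP mA mB mC mD bA,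
        pinner (P + Q) R = pinner P R + pinner Q R) ∧
    (∀ (c : ℝ), ∀ P ∈ CIP mA mB mC mD bA, ∀ Q ∈ CIP mA mB mC mD bA,
        pinner (c • P) Q = c * pinner P Q) ∧
    (∀ P ∈ CIP mA mB mC mD bA, 0 ≤ pinner P P) ∧
    (∀ P ∈ CIP mA mB mC mD bA, (pinner P P = 0 ↔ P = (0 : Fin 9 → ℝ))) := by
  refine ⟨fun P _ Q _ => ?_, fun P _ Q _ R _ => ?_, fun c P _ Q _ => ?_, fun P _ => ?_,
    fun P hP => ⟨CIP.eq_zero_of_pinner_self_eq_zero hCD hP, ?_⟩⟩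
  · simp only [pinner, dot2]
    ring
  · simp only [pinner, dot2, vAC, vBD, Pi.add_apply]
    ring
  · simp only [pinner, dot2, vAC, vBD, Pi.smul_apply, smul_eq_mul]
    ring
  · simp only [pinner, dot2]
    nlinarith only [mul_self_nonneg (vAC P).1, mul_self_nonneg (vAC P).2,
      mul_self_nonneg (vBD P).1, mul_self_nonneg (vBD P).2]
  · rintro rfl
    simp [pinner, dot2, vAC, vBD]
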